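/- Over F = ℝ, let ψ₁ = ψ₂ = ⟨⟨−1,…,−1⟩⟩ be the n-fold Pfister form with all slots equal to −1 (the form of 2^n squares). For each k ∈ {1,…,n−1}, the forms ψ₁ and ψ₂ are (k+1)-linked, yet their k-invariant is F_k(ψ₁, ψ₂) ≅ ⟨⟨−1,…,−1⟩⟩ with 2n−k slots, which is anisotropic and in particular not hyperbolic. Hence the hypothesis that −1 is a square cannot be dropped from the statement that (k+1)-linkage implies triviality of the k-invariant. -/

import Mathlib

noncomputable section

open QuadraticMap

/-- A quadratic form over `F` on the space `F^d`, bundled together with its dimension `d`. -/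
structure QF (F : Type) [Field F] where
  dim : ℕ
  form : QuadraticForm F (Fin dim → F)

namespace QF

variable {F : Type} [Field F]

/-- Isometry of bundled quadratic forms. -/
def Equiv (q q' : QF F) : Prop := QuadraticMap.Equivalent q.form q'.form

/-- The standard linear equivalence `F^(a+b) ≃ F^a × F^b`. -/
def finSplit (F : Type) [Field F] (a b : ℕ) :
    (Fin (a + b) → F) ≃ₗ[F] (Fin a → F) × (Fin b → F) :=
  (LinearEquiv.funCongrLeft F F finSumFinEquiv).trans
    (LinearEquiv.sumArrowLequivProdArrow _ _ F F)

/-- Orthogonal sum of bundled quadratic forms. -/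
def sum (q₁ q₂ : QF F) : QF F :=
  ⟨q₁.dim + q₂.dim, (q₁.form.prod q₂.form).comp (finSplit F q₁.dim q₂.dim).toLinearMap⟩

instance : Neg (QF F) := ⟨fun q => ⟨q.dim, -q.form⟩⟩

instance : SMul F (QF F) := ⟨fun a q => ⟨q.dim, a • q.form⟩⟩

/-- `⟨⟨γ⟩⟩ ⊗ q = q ⊥ (−γ)·q` : twisting a quadratic form by the
1-fold bilinear Pfister form `⟨⟨γ⟩⟩ = ⟨1, −γ⟩`. -/
def twist (γ : F) (q : QF F) : QF F := q.sum ((-γ) • q)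

/-- `⟨⟨γ₁,…,γ_m⟩⟩ ⊗ q` : tensoring a quadratic form with the `m`-fold bilinear
Pfister form whose slots are the entries of the list `l = [γ₁,…,γ_m]`. -/
def btensor (l : List F) (q : QF F) : QF F := l.foldr twist q

/-- The zero form on the zero space. -/
def zero (F : Type) [Field F] : QF F := ⟨0, 0⟩

/-- The one-dimensional form `⟨1⟩`, `x ↦ x²`. -/
def unit (F : Type) [Field F] : QF F := ⟨1, QuadraticMap.sq.comp (LinearMap.proj 0)⟩

/-- The binary quadratic form `[1,α] : (x,y) ↦ x² + xy + αy²`. -/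
def binary (α : F) : QF F := ⟨2, (Matrix.of ![![1, 1], ![0, α]]).toQuadraticMap'⟩

/-- The hyperbolic plane `ℍ : (x,y) ↦ xy`. -/
def hyp (F : Type) [Field F] : QF F := ⟨2, (Matrix.of ![![0, 1], ![0, 0]]).toQuadraticMap'⟩

/-- `m × ℍ`, the orthogonal sum of `m` hyperbolic planes. -/
def hyps (F : Type) [Field F] : ℕ → QF F
  | 0 => zero F
  | n + 1 => (hyp F).sum (hyps F n)

/-- A quadratic form is isotropic if it represents `0` nontrivially. -/
def Isotropic (q : QF F) : Prop := ∃ v, q.form v = 0 ∧ v ≠ 0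

/-- A quadratic form is hyperbolic if it is isometric to an orthogonal
sum of hyperbolic planes. -/
def Hyperbolic (q : QF F) : Prop := ∃ m, q.Equiv (hyps F m)

/-- All entries of the list are nonzero (the slots of a bilinear Pfister form
must be units). -/
def UnitList (l : List F) : Prop := ∀ γ ∈ l, γ ≠ 0

/-- `q` is an `n`-fold quadratic Pfister form.  In characteristic `2` this means
`q ≅ ⟨⟨γ₁,…,γ_{n−1}, α]] = ⟨⟨γ₁,…,γ_{n−1}⟩⟩ ⊗ [1,α]`; in characteristic `≠ 2` it means
`q ≅ ⟨⟨γ₁,…,γ_n⟩⟩ = ⟨1,−γ₁⟩ ⊗ ⋯ ⊗ ⟨1,−γ_n⟩`. -/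
def IsQPfister (n : ℕ) (q : QF F) : Prop :=
  if ringChar F = 2 then
    ∃ (l : List F) (α : F), UnitList l ∧ l.length + 1 = n ∧ (btensor l (binary α)).Equiv q
  else
    ∃ l : List F, UnitList l ∧ l.length = n ∧ (btensor l (unit F)).Equiv q

/-- `φ` is a `k`-fold quadratic Pfister factor of `ψ`, i.e. `ψ ≅ B ⊗ φ` for some
bilinear Pfister form `B`. -/
def IsQPfisterFactor (k : ℕ) (φ ψ : QF F) : Prop :=
  IsQPfister k φ ∧ ∃ l : List F, UnitList l ∧ (btensor l φ).Equiv ψ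

/-- A finite family of quadratic Pfister forms is (separably) `k`-linked if its members
share a common `k`-fold quadratic Pfister factor. -/
def SepLinked (k : ℕ) (ψs : List (QF F)) : Prop :=
  ∃ π : QF F, IsQPfister k π ∧
    ∀ ψ ∈ ψs, ∃ l : List F, UnitList l ∧ (btensor l π).Equiv ψ

/-- A finite family of quadratic Pfister forms is inseparably `k`-linked if its members
share a common `k`-fold bilinear Pfister factor. -/
def InsepLinked (k : ℕ) (ψs : List (QF F)) : Prop :=
  ∃ l : List F, UnitList l ∧ l.length = k ∧
    ∀ ψ ∈ ψs, ∃ (n : ℕ) (π : QF F), IsQPfister n π ∧ (btensor l π).Equiv ψ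

/-- `q` is the value of the two-form invariant `F²_k(ψ₁, ψ₂) = φ₁ ⊗ φ₂ ⊗ π`
for some presentation `ψ₁ ≅ φ₁ ⊗ π`, `ψ₂ ≅ φ₂ ⊗ π`. -/
def IsPairInv (k : ℕ) (ψ₁ ψ₂ q : QF F) : Prop :=
  ∃ (π : QF F) (l₁ l₂ : List F), IsQPfister k π ∧ UnitList l₁ ∧ UnitList l₂ ∧
    (btensor l₁ π).Equiv ψ₁ ∧ (btensor l₂ π).Equiv ψ₂ ∧
    q.Equiv (btensor l₁ (btensor l₂ π))

/-- `IsInv k ψs q` : `q` is a value of the inductively defined invariant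
`F^m_k(ψ₁,…,ψ_m)`, where `F¹_k(ψ) = ψ` and
`F^m_k(ψ₁,…,ψ_m) = F²_k(F^{m−1}_k(ψ₁,…,ψ_{m−1}), ψ_m)`. -/
inductive IsInv (k : ℕ) : List (QF F) → QF F → Prop
  | single (ψ : QF F) : IsInv k [ψ] ψ
  | step {ψs : List (QF F)} {ψ q' q : QF F} :
      IsInv k ψs q' → IsPairInv k q' ψ q → IsInv k (ψs ++ [ψ]) q

end QF
namespace QF

variable {F : Type} [Field F]

/-- The (upper triangular) Gram-type matrix of a bundled quadratic form:
`q(∑ xᵢ eᵢ) = ∑ᵢ q(eᵢ) xᵢ² + ∑_{i<j} polar(eᵢ,eⱼ) xᵢ xⱼ`. -/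
def matrixOf (q : QF F) : Matrix (Fin q.dim) (Fin q.dim) F := fun i j =>
  if i = j then q.form (Pi.single i 1)
  else if i < j then polar q.form (Pi.single i 1) (Pi.single j 1)
  else 0

/-- Base change (extension of scalars) of a bundled quadratic form along a
ring homomorphism of fields. -/
def baseChange {E : Type} [Field E] (σ : F →+* E) (q : QF F) : QF E :=
  ⟨q.dim, (q.matrixOf.map σ).toQuadraticMap'⟩

/-- The homogeneous degree-2 polynomial cut out by a bundled quadratic form. -/
def toPoly (q : QF F) : MvPolynomial (Fin q.dim) F :=
  ∑ i, ∑ j, MvPolynomial.C (q.matrixOf i j) * (MvPolynomial.X i * MvPolynomial.X j)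

/-- The affine coordinate ring of the quadric `q = 0`. -/
def coordRing (q : QF F) : Type :=
  MvPolynomial (Fin q.dim) F ⧸ Ideal.span {q.toPoly}

instance (q : QF F) : CommRing q.coordRing := Ideal.Quotient.commRing _
instance (q : QF F) : Algebra F q.coordRing := Ideal.Quotient.algebra F

/-- The function field `F(q)` of the quadric `q = 0` (assuming the coordinate
ring is a domain). -/
def funField (q : QF F) : Type := FractionRing q.coordRing

instance (q : QF F) : CommRing q.funField := by unfold funField; infer_instance

noncomputable instance (q : QF F) [IsDomain q.coordRing] : Field q.funField := by
  unfold funField; infer_instance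

/-- The canonical embedding `F → F(q)`. -/
noncomputable def toFunField (q : QF F) : F →+* q.funField :=
  (algebraMap q.coordRing (FractionRing q.coordRing)).comp (algebraMap F q.coordRing)

/-- `⟨⟨γ₁,…,γ_m⟩⟩′ ⊗ q` : the tensor product with `q` of the pure part of the
bilinear Pfister form with slots `γ₁,…,γ_m`, so that
`⟨⟨l⟩⟩ ⊗ q ≅ q ⊥ (⟨⟨l⟩⟩′ ⊗ q)`. -/
def bpure : List F → QF F → QF F
  | [], _ => zero F
  | γ :: l, q => (bpure l q).sum ((-γ) • btensor l q)

end QF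

namespace QF

variable {F : Type} [Field F]

theorem dim_twist (γ : F) (q : QF F) : (twist γ q).dim = 2 * q.dim :=
  (two_mul _).symm

theorem dim_btensor (l : List F) (q : QF F) : (btensor l q).dim = 2 ^ l.length * q.dim := by
  induction l with
  | nil => simp [btensor]
  | cons γ l ih =>
    rw [List.length_cons, pow_succ', mul_assoc, ← ih]
    exact dim_twist γ _

theorem btensor_append (l₁ l₂ : List F) (q : QF F) :
    btensor (l₁ ++ l₂) q = btensor l₁ (btensor l₂ q) :=
  List.foldr_append

theorem Equiv.dim_eq {q q' : QF F} (h : q.Equiv q') : q.dim = q'.dim := by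
  obtain ⟨e⟩ := h
  simpa using e.toLinearEquiv.finrank_eq

theorem Equiv.posDef_iff {q q' : QF ℝ} (h : q.Equiv q') : q.form.PosDef ↔ q'.form.PosDef := by
  obtain ⟨e⟩ := h
  constructor
  · intro hq x hx
    have := hq (e.symm x) (by simpa using hx)
    rwa [QuadraticMap.IsometryEquiv.map_app] at this
  · intro hq x hx
    have := hq (e x) (by simpa using hx)
    rwa [QuadraticMap.IsometryEquiv.map_app] at this

theorem posDef_sum_iff (q q' : QF ℝ) :
    (q.sum q').form.PosDef ↔ q.form.PosDef ∧ q'.form.PosDef := by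
  rw [← QuadraticMap.posDef_prod_iff]
  constructor
  · intro h x hx
    have := h ((finSplit ℝ q.dim q'.dim).symm x)
      ((finSplit ℝ q.dim q'.dim).symm.map_ne_zero_iff.2 hx)
    change 0 < q.form.prod q'.form (finSplit ℝ q.dim q'.dim _) at this
    rwa [LinearEquiv.apply_symm_apply] at this
  · intro h x hx
    exact h (finSplit ℝ q.dim q'.dim x) ((finSplit ℝ q.dim q'.dim).map_ne_zero_iff.2 hx)

theorem posDef_twist_iff {γ : ℝ} {q : QF ℝ} (hq : 0 < q.dim) :
    (twist γ q).form.PosDef ↔ γ < 0 ∧ q.form.PosDef := by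
  refine (posDef_sum_iff q _).trans ?_
  constructor
  · rintro ⟨h, h'⟩
    have hv : (fun _ : Fin q.dim ↦ (1 : ℝ)) ≠ 0 :=
      fun h0 ↦ one_ne_zero (congrFun h0 ⟨0, hq⟩)
    have h₂ : 0 < -γ * q.form fun _ ↦ 1 := h' _ hv
    exact ⟨neg_pos.1 (pos_of_mul_pos_left h₂ (h _ hv).le), h⟩
  · exact fun ⟨hγ, h⟩ ↦ ⟨h, h.smul (neg_pos.2 hγ)⟩

theorem posDef_btensor_iff {l : List ℝ} {q : QF ℝ} (hq : 0 < q.dim) :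
    (btensor l q).form.PosDef ↔ (∀ γ ∈ l, γ < 0) ∧ q.form.PosDef := by
  induction l with
  | nil => exact (and_iff_right fun _ h ↦ absurd h List.not_mem_nil).symm
  | cons γ l ih =>
    have hl : 0 < (btensor l q).dim := by rw [dim_btensor]; positivity
    rw [List.forall_mem_cons, and_assoc, ← ih]
    exact posDef_twist_iff hl

theorem posDef_unit : (unit ℝ).form.PosDef := by
  intro x hx
  refine mul_self_pos.2 fun h ↦ hx ?_
  ext i
  obtain rfl : i = (0 : Fin 1) := Subsingleton.elim (α := Fin 1) i 0
  exact h

theorem posDef_btensor_replicate (m : ℕ) :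
    (btensor (List.replicate m (-1)) (unit ℝ)).form.PosDef :=
  (posDef_btensor_iff one_pos).2
    ⟨fun γ hγ ↦ by simp [List.eq_of_mem_replicate hγ], posDef_unit⟩

theorem dim_btensor_replicate (m : ℕ) (a : F) :
    (btensor (List.replicate m a) (unit F)).dim = 2 ^ m := by
  rw [dim_btensor, List.length_replicate]
  exact mul_one _

/-- A positive definite real quadratic form is a sum of squares. -/
theorem equivalent_sumSquares_of_posDef {m : ℕ} {Q : QuadraticForm ℝ (Fin m → ℝ)}
    (hQ : Q.PosDef) :
    Q.Equivalent (weightedSumSquares ℝ fun _ : Fin m ↦ (1 : ℝ)) := by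
  obtain ⟨w, ⟨e⟩⟩ := Q.equivalent_signType_weighted_sum_squared
  have hw : ∀ i, w i = 1 := by
    intro i
    have h := hQ (e.symm (Pi.single i 1)) (by simp)
    rw [QuadraticMap.IsometryEquiv.map_app] at h
    have h' : 0 < ((w i : SignType) : ℝ) := by
      simpa [weightedSumSquares_apply, Pi.single_apply] using h
    cases hi : w i <;> simp_all; linarith
  obtain rfl : w = fun _ ↦ 1 := funext hw
  have hm : Module.finrank ℝ (Fin m → ℝ) = m := by simp
  generalize Module.finrank ℝ (Fin m → ℝ) = d at hm e
  subst hm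
  simp only [SignType.coe_one] at e
  exact ⟨e⟩

theorem equiv_of_posDef {q q' : QF ℝ} (hq : q.form.PosDef) (hq' : q'.form.PosDef)
    (h : q.dim = q'.dim) : q.Equiv q' := by
  obtain ⟨d, Q⟩ := q
  obtain ⟨d', Q'⟩ := q'
  obtain rfl : d = d' := h
  exact (equivalent_sumSquares_of_posDef hq).trans (equivalent_sumSquares_of_posDef hq').symm

theorem not_isotropic_of_posDef {q : QF ℝ} (hq : q.form.PosDef) : ¬ q.Isotropic :=
  fun ⟨v, hv, hv0⟩ ↦ (hq v hv0).ne' hv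

theorem not_hyperbolic_of_posDef {q : QF ℝ} (hq : q.form.PosDef) (hd : 0 < q.dim) :
    ¬ q.Hyperbolic := by
  rintro ⟨m, hm⟩
  have hp := hm.posDef_iff.1 hq
  cases m with
  | zero => exact hd.ne' hm.dim_eq
  | succ m =>
    have h := ((posDef_sum_iff (hyp ℝ) (hyps ℝ m)).1 hp).1 ![1, 0]
      fun h0 ↦ one_ne_zero (congrFun h0 (0 : Fin 2))
    have h₀ : (hyp ℝ).form ![1, 0] = 0 := by
      change Matrix.toLinearMap₂' ℝ !![(0 : ℝ), 1; 0, 0] ![1, 0] ![1, 0] = 0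
      simp [Matrix.toLinearMap₂'_apply', Matrix.vecHead]
    exact h.ne' h₀

theorem isQPfister_real_iff {n : ℕ} {q : QF ℝ} :
    IsQPfister n q ↔
      ∃ l : List ℝ, UnitList l ∧ l.length = n ∧ (btensor l (unit ℝ)).Equiv q := by
  have h : ringChar ℝ ≠ 2 := by simp [ringChar.eq_zero]
  rw [IsQPfister, if_neg h]

theorem unitList_replicate (m : ℕ) {a : F} (ha : a ≠ 0) : UnitList (List.replicate m a) :=
  fun _ hγ ↦ List.eq_of_mem_replicate hγ ▸ ha

end QF

/-- Over `F = ℝ`, let `ψ₁ = ψ₂ = ⟨⟨−1,…,−1⟩⟩` be the `n`-fold Pfister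
form with all slots `−1` (the form of `2^n` squares).  For each `k ∈ {1,…,n−1}`, the
forms `ψ₁`, `ψ₂` are `(k+1)`-linked, yet their `k`-invariant is
`⟨⟨−1,…,−1⟩⟩` with `2n−k` slots, which is anisotropic and in particular not hyperbolic. -/
theorem real_counterexample
    (n k : ℕ) (hk : 1 ≤ k) (hkn : k < n) :
    QF.SepLinked (k + 1)
        [QF.btensor (List.replicate n (-1)) (QF.unit ℝ),
         QF.btensor (List.replicate n (-1)) (QF.unit ℝ)] ∧
      (∀ q, QF.IsPairInv k
          (QF.btensor (List.replicate n (-1)) (QF.unit ℝ))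
          (QF.btensor (List.replicate n (-1)) (QF.unit ℝ)) q →
        q.Equiv (QF.btensor (List.replicate (2 * n - k) (-1)) (QF.unit ℝ))) ∧
      ¬ (QF.btensor (List.replicate (2 * n - k) (-1)) (QF.unit ℝ)).Isotropic ∧
      ¬ (QF.btensor (List.replicate (2 * n - k) (-1)) (QF.unit ℝ)).Hyperbolic := by
  have h₁ : (-1 : ℝ) ≠ 0 := by norm_num
  refine ⟨?_, ?_, QF.not_isotropic_of_posDef (QF.posDef_btensor_replicate _),
    QF.not_hyperbolic_of_posDef (QF.posDef_btensor_replicate _)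
      (by rw [QF.dim_btensor_replicate]; positivity)⟩
  · refine ⟨QF.btensor (List.replicate (k + 1) (-1)) (QF.unit ℝ), QF.isQPfister_real_iff.2
      ⟨_, QF.unitList_replicate _ h₁, List.length_replicate, .refl _⟩, fun ψ hψ ↦
      ⟨List.replicate (n - (k + 1)) (-1), QF.unitList_replicate _ h₁, ?_⟩⟩
    obtain rfl : ψ = QF.btensor (List.replicate n (-1)) (QF.unit ℝ) := by simpa using hψ
    rw [← QF.btensor_append, List.replicate_append_replicate, Nat.sub_add_cancel hkn]
    exact .refl _
  · rintro q ⟨π, l₁, l₂, hπ, -, -, e₁, e₂, hq⟩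
    obtain ⟨l, -, hl, e⟩ := QF.isQPfister_real_iff.1 hπ
    have hdπ : π.dim = 2 ^ k := by
      rw [← e.dim_eq, QF.dim_btensor, hl]
      exact mul_one _
    have hπ₀ : 0 < π.dim := by rw [hdπ]; positivity
    have hneg₁ := ((QF.posDef_btensor_iff hπ₀).1
      (e₁.posDef_iff.2 (QF.posDef_btensor_replicate n))).1
    have hpos₂ := e₂.posDef_iff.2 (QF.posDef_btensor_replicate n)
    have hd₁ := e₁.dim_eq
    have hd₂ := e₂.dim_eq
    rw [QF.dim_btensor_replicate] at hd₁ hd₂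
    have hd₂₀ : 0 < (QF.btensor l₂ π).dim := by rw [hd₂]; positivity
    rw [QF.dim_btensor, hdπ, ← pow_add] at hd₁
    have hlen : l₁.length + k = n := Nat.pow_right_injective le_rfl hd₁
    refine hq.trans (QF.equiv_of_posDef ((QF.posDef_btensor_iff hd₂₀).2 ⟨hneg₁, hpos₂⟩)
      (QF.posDef_btensor_replicate _) ?_)
    rw [QF.dim_btensor, hd₂, QF.dim_btensor_replicate, ← pow_add]
    congr 1
    omega
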